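/- Let d ≥ 2 and m ≥ 1 be integers with (d−1) dividing (m+1), set a = (m+1)/(d−1), and let n ≥ 1 be an integer with m ≤ d^{n+1} − 3. Define x(m) to be the maximum over all primes p dividing d of ⌈(ν_p(a!) + ν_p(d)·a)/ν_p(d)⌉. Then B(d,m,n) · d^{x(m)} is an integer. -/

import Mathlib

/-- Generalized binomial coefficient `C_j(x) = x(x-1)⋯(x-j+1)/j!`, with `C_0(x) = 1`. -/
noncomputable def genBinom (x : ℚ) (j : ℕ) : ℚ :=
  (∏ i ∈ Finset.range j, (x - (i : ℚ))) / (Nat.factorial j : ℚ)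

/-- The Ewing–Schober combinatorial formula `B(d,m,n)`: the sum is over all tuples
`(j_1,…,j_n)` of nonnegative integers (here `j : Fin n → ℕ`, 0-indexed, so `j k`
corresponds to `j_{k+1}`) satisfying `Σ_{k=1}^n (d^{n-k+1} - 1) j_k = m + 1`, of
`Π_{k=1}^n C_{j_k}(m/d^{n-k+1} - Σ_{l=1}^{k-1} d^{k-l} j_l)`, multiplied by `-(1/m)`. -/
noncomputable def multibrotB (d m n : ℕ) : ℚ :=
  -(1 / (m : ℚ)) * ∑ᶠ j : Fin n → ℕ,
    if (∑ k : Fin n, (d ^ (n - k.val) - 1) * j k) = m + 1 then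
      ∏ k : Fin n,
        genBinom ((m : ℚ) / (d : ℚ) ^ (n - k.val)
          - ∑ l ∈ Finset.univ.filter (fun l : Fin n => l < k),
              (d : ℚ) ^ (k.val - l.val) * ((j l : ℕ) : ℚ)) (j k)
    else 0

open Finset

theorem genBinom_mul_factorial (x : ℚ) (j : ℕ) :
    genBinom x j * (j.factorial : ℚ) = ∏ i ∈ range j, (x - (i : ℚ)) := by
  rw [genBinom, div_mul_cancel₀]
  exact_mod_cast j.factorial_ne_zero

theorem natCast_succ_mul_genBinom_succ (x : ℚ) (j : ℕ) :
    ((j + 1 : ℕ) : ℚ) * genBinom x (j + 1) = x * genBinom (x - 1) j := by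
  have h : (j.factorial : ℚ) ≠ 0 := by exact_mod_cast j.factorial_ne_zero
  have h' : ((j + 1 : ℕ) : ℚ) ≠ 0 := by exact_mod_cast j.succ_ne_zero
  have hp : ∏ i ∈ range j, (x - 1 - (i : ℚ)) = ∏ i ∈ range j, (x - ((i + 1 : ℕ) : ℚ)) :=
    prod_congr rfl fun i _ ↦ by push_cast; ring
  rw [genBinom, genBinom, prod_range_succ', Nat.factorial_succ, hp]
  push_cast at h' ⊢
  field_simp
  ring

theorem descPochhammer_smeval_eq_prod_range {R : Type*} [CommRing R] (r : R) (n : ℕ) :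
    (descPochhammer ℤ n).smeval r = ∏ i ∈ range n, (r - (i : R)) := by
  induction n with
  | zero => simp
  | succ n ih =>
    rw [descPochhammer_succ_right, Polynomial.smeval_mul, ih, prod_range_succ]
    simp [Polynomial.smeval_sub, Polynomial.smeval_natCast]

/-- The rational numbers that are `p`-adically integral. -/
noncomputable def padicIntegralRat (p : ℕ) [Fact p.Prime] : Subring ℚ :=
  (PadicInt.subring p).comap (Rat.castHom ℚ_[p])

theorem mem_padicIntegralRat {p : ℕ} [Fact p.Prime] {x : ℚ} :
    x ∈ padicIntegralRat p ↔ ‖(x : ℚ_[p])‖ ≤ 1 := Iff.rfl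

theorem genBinom_mem_padicIntegralRat {p : ℕ} [Fact p.Prime] {x : ℚ}
    (hx : x ∈ padicIntegralRat p) (j : ℕ) : genBinom x j ∈ padicIntegralRat p := by
  let y : ℤ_[p] := ⟨(x : ℚ_[p]), hx⟩
  have h := Ring.descPochhammer_eq_factorial_smul_choose y j
  rw [descPochhammer_smeval_eq_prod_range, nsmul_eq_mul] at h
  have hf : ((j.factorial : ℕ) : ℚ_[p]) ≠ 0 := by exact_mod_cast j.factorial_ne_zero
  have hc : ((genBinom x j : ℚ) : ℚ_[p]) = (Ring.choose y j : ℤ_[p]) := by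
    have h' := congrArg (PadicInt.Coe.ringHom (p := p)) h
    rw [map_prod, map_mul, map_natCast] at h'
    refine mul_left_cancel₀ hf (Eq.trans ?_ h')
    rw [← Rat.cast_natCast, ← Rat.cast_mul, mul_comm, genBinom_mul_factorial, Rat.cast_prod]
    refine prod_congr rfl fun i _ ↦ ?_
    rw [map_sub, map_natCast, Rat.cast_sub, Rat.cast_natCast]
    rfl
  rw [mem_padicIntegralRat, hc]
  exact PadicInt.norm_le_one _

theorem exists_int_of_forall_mem_padicIntegralRat {q : ℚ}
    (h : ∀ p : ℕ, ∀ _ : Fact p.Prime, q ∈ padicIntegralRat p) : ∃ k : ℤ, q = k := by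
  have hden : q.den = 1 := by
    by_contra hne
    obtain ⟨p, hp, hpd⟩ := Nat.exists_prime_and_dvd hne
    have := Fact.mk hp
    have h1 := (Padic.norm_rat_le_one_iff_padicValuation_le_one p).1
      (mem_padicIntegralRat.1 (h p ‹_›))
    exact (Rat.padicValuation_le_one_iff.1 h1) hpd
  exact ⟨q.num, (Rat.den_eq_one_iff q).1 hden |>.symm⟩

/-- The argument of the binomial coefficient with index `k` in the Ewing–Schober formula. -/
noncomputable def ewingSchoberArg (d m n : ℕ) (j : Fin n → ℕ) (k : Fin n) : ℚ :=
  (m : ℚ) / (d : ℚ) ^ (n - k.val)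
    - ∑ l ∈ univ.filter (fun l : Fin n => l < k),
        (d : ℚ) ^ (k.val - l.val) * ((j l : ℕ) : ℚ)

theorem ewingSchoberArg_mem {R : Subring ℚ} {d : ℕ} (hd : (d : ℚ)⁻¹ ∈ R) (m n : ℕ)
    (j : Fin n → ℕ) (k : Fin n) : ewingSchoberArg d m n j k ∈ R := by
  refine sub_mem ?_ (sum_mem fun l _ ↦ mul_mem (pow_mem (natCast_mem R d) _) (natCast_mem R _))
  rw [div_eq_mul_inv, ← inv_pow]
  exact mul_mem (natCast_mem R m) (pow_mem hd _)

theorem natCast_mul_prod_genBinom_div_mem {R : Subring ℚ} {d : ℕ} (hd : (d : ℚ)⁻¹ ∈ R)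
    (hR : ∀ x ∈ R, ∀ j, genBinom x j ∈ R) {m : ℕ} (hm : m ≠ 0) {n : ℕ} (j : Fin n → ℕ)
    (k : Fin n) (S : Finset (Fin n)) (hS : Iic k ⊆ S) :
    (j k : ℚ) * (∏ l ∈ S, genBinom (ewingSchoberArg d m n j l) (j l)) / m ∈ R := by
  have hm' : (m : ℚ) ≠ 0 := by exact_mod_cast hm
  induction k using WellFoundedLT.induction generalizing S with
  | ind k ih =>
    obtain h0 | h0 := eq_or_ne (j k) 0
    · simp [h0]
    obtain ⟨i, hi⟩ := Nat.exists_eq_succ_of_ne_zero h0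
    have hk : k ∈ S := hS (mem_Iic.2 le_rfl)
    set x := ewingSchoberArg d m n j with hx
    set P := ∏ l ∈ S.erase k, genBinom (x l) (j l) with hP
    have hPR : P ∈ R := prod_mem fun l _ ↦ hR _ (ewingSchoberArg_mem hd m n j l) _
    have hl : ∀ l < k, (j l : ℚ) * P / m ∈ R := fun l hl ↦ ih l hl _ fun s hs ↦
      mem_erase.2 ⟨((mem_Iic.1 hs).trans_lt hl).ne, hS (mem_Iic.2 ((mem_Iic.1 hs).trans hl.le))⟩
    have hxP : x k * P / m ∈ R := by
      have : x k * P / m = (d : ℚ)⁻¹ ^ (n - k.val) * P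
          - ∑ l ∈ univ.filter (fun l : Fin n => l < k),
            (d : ℚ) ^ (k.val - l.val) * ((j l : ℚ) * P / m) := by
        simp only [mul_div_assoc, ← mul_assoc]
        rw [← sum_mul, hx, ewingSchoberArg, inv_pow]
        field_simp
      rw [this]
      refine sub_mem (mul_mem (pow_mem hd _) hPR) (sum_mem fun l hlk ↦ ?_)
      exact mul_mem (pow_mem (natCast_mem R d) _) (hl l (mem_filter.1 hlk).2)
    rw [← mul_prod_erase S _ hk, ← hP, ← mul_assoc]
    have hjk : (j k : ℚ) * genBinom (x k) (j k) = x k * genBinom (x k - 1) i := by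
      rw [hi]; exact natCast_succ_mul_genBinom_succ _ _
    have hxk : x k ∈ R := ewingSchoberArg_mem hd m n j k
    rw [hjk, show x k * genBinom (x k - 1) i * P / m
      = genBinom (x k - 1) i * (x k * P / m) by ring]
    exact mul_mem (hR _ (sub_mem hxk (one_mem R)) _) hxP

theorem prod_genBinom_div_mem {R : Subring ℚ} {d : ℕ} (hd : (d : ℚ)⁻¹ ∈ R)
    (hR : ∀ x ∈ R, ∀ j, genBinom x j ∈ R) {m : ℕ} (hm : m ≠ 0) {n : ℕ} {j : Fin n → ℕ}
    (hj : (∑ k : Fin n, (d ^ (n - k.val) - 1) * j k) = m + 1) :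
    (∏ l, genBinom (ewingSchoberArg d m n j l) (j l)) / m ∈ R := by
  have hm' : (m : ℚ) ≠ 0 := by exact_mod_cast hm
  set T := ∏ l, genBinom (ewingSchoberArg d m n j l) (j l) with hT
  have hTR : T ∈ R := prod_mem fun l _ ↦ hR _ (ewingSchoberArg_mem hd m n j l) _
  have hsum : ∑ k : Fin n, ((d ^ (n - k.val) - 1 : ℕ) : ℚ) * ((j k : ℚ) * T / m) ∈ R :=
    sum_mem fun k _ ↦ mul_mem (natCast_mem R _)
      (natCast_mul_prod_genBinom_div_mem hd hR hm j k univ (subset_univ _))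
  have hj' : ∑ k : Fin n, ((d ^ (n - k.val) - 1 : ℕ) : ℚ) * (j k : ℚ) = m + 1 := by
    exact_mod_cast hj
  simp only [mul_div_assoc, ← mul_assoc] at hsum
  rw [← sum_mul, hj'] at hsum
  have : T / m = (m + 1) * (T / m) - T := by field_simp; ring
  rw [this]
  exact sub_mem hsum hTR

theorem exists_int_genBinom_mul {d : ℕ} (hd : d ≠ 0) (m n : ℕ) (j : Fin n → ℕ) (k : Fin n) :
    ∃ z : ℤ, genBinom (ewingSchoberArg d m n j k) (j k)
      * ((d : ℚ) ^ ((n - k.val) * j k) * ((j k).factorial : ℚ)) = z := by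
  have hd' : (d : ℚ) ≠ 0 := by exact_mod_cast hd
  refine ⟨∏ i ∈ range (j k), ((m : ℤ) - (d : ℤ) ^ (n - k.val) *
    (∑ l ∈ univ.filter (fun l : Fin n => l < k), (d : ℤ) ^ (k.val - l.val) * (j l : ℤ) + i)), ?_⟩
  rw [mul_comm ((d : ℚ) ^ _), ← mul_assoc, genBinom_mul_factorial, pow_mul]
  nth_rw 2 [← card_range (j k)]
  rw [← prod_const, ← prod_mul_distrib]
  push_cast
  refine prod_congr rfl fun i _ ↦ ?_
  rw [ewingSchoberArg]
  field_simp
  ring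

theorem exists_int_genBinom_mul_div {d : ℕ} (hd : d ≠ 0) {m n : ℕ}
    {j : Fin n → ℕ} {k : Fin n} (hk : j k ≠ 0) (hlt : ∀ l < k, j l = 0) :
    ∃ z : ℤ, genBinom (ewingSchoberArg d m n j k) (j k)
      * ((d : ℚ) ^ ((n - k.val) * j k) * ((j k).factorial : ℚ)) = m * z := by
  have hd' : (d : ℚ) ≠ 0 := by exact_mod_cast hd
  obtain ⟨i, hi⟩ := Nat.exists_eq_succ_of_ne_zero hk
  refine ⟨∏ i ∈ range i, ((m : ℤ) - (d : ℤ) ^ (n - k.val) * ((i + 1 : ℕ) : ℤ)), ?_⟩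
  have harg : ewingSchoberArg d m n j k = (m : ℚ) / (d : ℚ) ^ (n - k.val) := by
    rw [ewingSchoberArg, sum_eq_zero, sub_zero]
    intro l hl
    simp [hlt l (mem_filter.1 hl).2]
  rw [mul_comm ((d : ℚ) ^ _), ← mul_assoc, genBinom_mul_factorial, pow_mul, harg, hi]
  nth_rw 2 [← card_range i.succ]
  rw [← prod_const, ← prod_mul_distrib, prod_range_succ', mul_comm]
  push_cast
  congr 1
  · field_simp
    simp
  · refine prod_congr rfl fun i _ ↦ ?_
    field_simp

theorem exists_int_prod_genBinom_mul_div {d : ℕ} (hd : d ≠ 0) {m : ℕ} (hm : m ≠ 0) {n : ℕ}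
    {j : Fin n → ℕ} (hj : j ≠ 0) :
    ∃ z : ℤ, (∏ k, genBinom (ewingSchoberArg d m n j k) (j k)) / m
      * ((d ^ (∑ k, (n - k.val) * j k) * ∏ k, (j k).factorial : ℕ) : ℚ) = z := by
  have hm' : (m : ℚ) ≠ 0 := by exact_mod_cast hm
  obtain ⟨k, hk, hlt⟩ : ∃ k, j k ≠ 0 ∧ ∀ l < k, j l = 0 := by
    obtain ⟨k₀, hk₀⟩ := Function.ne_iff.1 hj
    obtain ⟨k, hk, hmin⟩ := wellFounded_lt.has_min {k | j k ≠ 0} ⟨k₀, hk₀⟩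
    exact ⟨k, hk, fun l hl ↦ by_contra fun h ↦ hmin l h hl⟩
  obtain ⟨z, hz⟩ := exists_int_genBinom_mul_div (m := m) hd hk hlt
  choose w hw using exists_int_genBinom_mul hd m n j
  refine ⟨z * ∏ l ∈ univ.erase k, w l, ?_⟩
  push_cast
  rw [← prod_pow_eq_pow_sum, ← prod_mul_distrib, div_mul_eq_mul_div, ← prod_mul_distrib,
    ← mul_prod_erase univ _ (mem_univ k), hz, prod_congr rfl fun l _ ↦ hw l]
  field_simp

theorem pow_mul_prod_factorial_dvd {d : ℕ} (hd : 2 ≤ d) {m n : ℕ} {j : Fin n → ℕ} {a : ℕ}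
    (ha : (d - 1) * a = m + 1) (hj : (∑ k : Fin n, (d ^ (n - k.val) - 1) * j k) = m + 1) :
    d ^ (∑ k, (n - k.val) * j k) * ∏ k, (j k).factorial ∣ d ^ a * a.factorial := by
  have hle : ∑ k : Fin n, (n - k.val) * j k ≤ a := by
    refine Nat.le_of_mul_le_mul_left ?_ (show 0 < d - 1 by omega)
    rw [ha, ← hj, mul_sum]
    refine sum_le_sum fun k _ ↦ ?_
    rw [← mul_assoc]
    refine Nat.mul_le_mul_right _ ?_
    have := one_add_mul_le_pow (show (-2 : ℤ) ≤ ((d - 1 : ℕ) : ℤ) by omega) (n - k.val)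
    have h2 : (1 : ℤ) + ((d - 1 : ℕ) : ℤ) = d := by omega
    rw [h2] at this
    have h3 : 1 + (n - k.val) * (d - 1) ≤ d ^ (n - k.val) := by exact_mod_cast this
    rw [mul_comm]
    omega
  have hle' : ∑ k, j k ≤ a := le_trans (sum_le_sum fun k _ ↦
    Nat.le_mul_of_pos_left _ (Nat.sub_pos_of_lt k.isLt)) hle
  exact mul_dvd_mul (pow_dvd_pow _ hle)
    ((Nat.prod_factorial_dvd_factorial_sum _ _).trans (Nat.factorial_dvd_factorial hle'))

theorem prod_genBinom_div_mul_pow_mem {d : ℕ} (hd : 2 ≤ d) {m : ℕ} (hm : m ≠ 0) {n : ℕ}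
    {j : Fin n → ℕ} {a : ℕ} (ha : (d - 1) * a = m + 1)
    (hj : (∑ k : Fin n, (d ^ (n - k.val) - 1) * j k) = m + 1)
    {p : ℕ} [Fact p.Prime] {x : ℕ}
    (hx : padicValNat p (d ^ a * a.factorial) ≤ padicValNat p (d ^ x)) :
    (∏ k, genBinom (ewingSchoberArg d m n j k) (j k)) / m * (d : ℚ) ^ x
      ∈ padicIntegralRat p := by
  have hj0 : j ≠ 0 := by
    rintro rfl
    simp at hj
  obtain ⟨z, hz⟩ := exists_int_prod_genBinom_mul_div (by omega : d ≠ 0) hm hj0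
  obtain ⟨w, hw⟩ := pow_mul_prod_factorial_dvd hd ha hj
  set t := (∏ k, genBinom (ewingSchoberArg d m n j k) (j k)) / m
  have hN : t * ((d ^ a * a.factorial : ℕ) : ℚ) = (z * w : ℤ) := by
    rw [hw, Nat.cast_mul, ← mul_assoc, hz]; push_cast; ring
  have hp1 : (1 : ℝ) < p := by exact_mod_cast (Fact.out : p.Prime).one_lt
  have hnorm : ‖((d ^ x : ℕ) : ℚ_[p])‖ ≤ ‖((d ^ a * a.factorial : ℕ) : ℚ_[p])‖ := by
    have h1 : d ^ x ≠ 0 := pow_ne_zero _ (by omega)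
    have h2 : d ^ a * a.factorial ≠ 0 :=
      mul_ne_zero (pow_ne_zero _ (by omega)) a.factorial_ne_zero
    rw [Padic.norm_eq_zpow_neg_valuation (by exact_mod_cast h1),
      Padic.norm_eq_zpow_neg_valuation (by exact_mod_cast h2), Padic.valuation_natCast,
      Padic.valuation_natCast]
    exact zpow_le_zpow_right₀ hp1.le (by omega)
  rw [mem_padicIntegralRat]
  calc ‖((t * (d : ℚ) ^ x : ℚ) : ℚ_[p])‖
      = ‖(t : ℚ_[p])‖ * ‖((d ^ x : ℕ) : ℚ_[p])‖ := by push_cast; rw [norm_mul]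
    _ ≤ ‖(t : ℚ_[p])‖ * ‖((d ^ a * a.factorial : ℕ) : ℚ_[p])‖ := by gcongr
    _ = ‖((t * ((d ^ a * a.factorial : ℕ) : ℚ) : ℚ) : ℚ_[p])‖ := by push_cast; simp only [norm_mul]
    _ ≤ 1 := by
      rw [hN, Rat.cast_intCast]
      exact Padic.norm_int_le_one _

theorem inv_natCast_mem_padicIntegralRat {p d : ℕ} [Fact p.Prime] (h : ¬ p ∣ d) :
    (d : ℚ)⁻¹ ∈ padicIntegralRat p := by
  rw [mem_padicIntegralRat, Rat.cast_inv, norm_inv, Rat.cast_natCast,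
    Padic.norm_natCast_eq_one_iff.2 ((Nat.Prime.coprime_iff_not_dvd Fact.out).2 h), inv_one]

theorem padicValNat_le_of_ceil_le {p d a : ℕ} [Fact p.Prime] (hd : d ≠ 0) (hpd : p ∣ d) {x : ℤ}
    (hx : ⌈((padicValNat p a.factorial : ℚ) + (padicValNat p d : ℚ) * (a : ℚ))
      / (padicValNat p d : ℚ)⌉ ≤ x) :
    0 ≤ x ∧ padicValNat p (d ^ a * a.factorial) ≤ padicValNat p (d ^ x.toNat) := by
  have hv : (0 : ℚ) < padicValNat p d := by
    exact_mod_cast one_le_padicValNat_of_dvd hd hpd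
  have h := (div_le_iff₀ hv).1 (Int.ceil_le.1 hx)
  have hx0 : 0 ≤ x := by
    refine le_trans (Int.ceil_nonneg ?_) hx
    positivity
  refine ⟨hx0, ?_⟩
  lift x to ℕ using hx0
  rw [Int.cast_natCast] at h
  rw [Int.toNat_natCast, padicValNat.mul (pow_ne_zero _ hd) a.factorial_ne_zero,
    padicValNat.pow, padicValNat.pow]
  have h' : padicValNat p a.factorial + padicValNat p d * a ≤ x * padicValNat p d := by
    exact_mod_cast h
  linarith

theorem multibrotB_mul_d_pow_int (d m n : ℕ) (hd : 2 ≤ d) (hm : 1 ≤ m) (hn : 1 ≤ n)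
    (hdvd : (d - 1) ∣ (m + 1)) (a : ℕ) (ha : a = (m + 1) / (d - 1))
    (hmn : m ≤ d ^ (n + 1) - 3)
    (x : ℤ)
    (hx : IsGreatest {y : ℤ | ∃ p ∈ Nat.primeFactors d,
        y = ⌈((padicValNat p (Nat.factorial a) : ℚ) + (padicValNat p d : ℚ) * (a : ℚ))
              / (padicValNat p d : ℚ)⌉} x) :
    ∃ k : ℤ, multibrotB d m n * (d : ℚ) ^ x = (k : ℚ) := by
  have hd0 : d ≠ 0 := by omega
  have ha' : (d - 1) * a = m + 1 := by rw [ha, Nat.mul_div_cancel' hdvd]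
  have hval : ∀ p : ℕ, ∀ _ : Fact p.Prime, p ∣ d →
      0 ≤ x ∧ padicValNat p (d ^ a * a.factorial) ≤ padicValNat p (d ^ x.toNat) :=
    fun p hp hpd ↦ padicValNat_le_of_ceil_le hd0 hpd
      (hx.2 ⟨p, Nat.mem_primeFactors.2 ⟨hp.out, hpd, hd0⟩, rfl⟩)
  obtain ⟨q, hq, -⟩ := hx.1
  have hx0 : 0 ≤ x := (hval q ⟨Nat.prime_of_mem_primeFactors hq⟩
    (Nat.dvd_of_mem_primeFactors hq)).1
  lift x to ℕ using hx0
  rw [multibrotB, zpow_natCast]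
  refine finsum_induction (fun y : ℚ ↦ ∃ k : ℤ, -(1 / (m : ℚ)) * y * (d : ℚ) ^ x = k)
    ⟨0, by simp⟩ ?_ fun j ↦ ?_
  · rintro y z ⟨k, hk⟩ ⟨l, hl⟩
    exact ⟨k + l, by push_cast; rw [← hk, ← hl]; ring⟩
  split_ifs with hj
  · have hint := exists_int_of_forall_mem_padicIntegralRat
      (q := (∏ k, genBinom (ewingSchoberArg d m n j k) (j k)) / m * (d : ℚ) ^ x) fun p hp ↦ by
        by_cases hpd : p ∣ d
        · exact prod_genBinom_div_mul_pow_mem hd (by omega) ha' hj (hval p hp hpd).2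
        · exact mul_mem (prod_genBinom_div_mem (inv_natCast_mem_padicIntegralRat hpd)
            (fun _ hy ↦ genBinom_mem_padicIntegralRat hy) (by omega) hj)
            (pow_mem (natCast_mem _ d) x)
    obtain ⟨k, hk⟩ := hint
    refine ⟨-k, ?_⟩
    push_cast
    rw [← hk]
    simp only [ewingSchoberArg]
    ring
  · exact ⟨0, by simp⟩
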